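/- A vector β ∈ ℝ^p is a global minimizer of the coop-Lasso objective L if and only if: (i) for every k and every j ∈ G_k with β_j ≠ 0, x_jᵀ(Xβ − y) + λ w_k β_j / ‖φ_j(β_{G_k})‖ = 0; and (ii) for every k and every j ∈ G_k with β_j = 0, ‖φ_j((X_{·G_k})ᵀ(Xβ − y))‖ ≤ λ w_k, where X_{·G_k} is the submatrix of X consisting of the columns indexed by G_k. -/

import Mathlib

open scoped BigOperators

/-- Euclidean norm of the positive part of `v` restricted to the index set `G`. -/
noncomputable def enormP {α : Type*} (G : Finset α) (v : α → ℝ) : ℝ :=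
  Real.sqrt (∑ j ∈ G, (max (v j) 0) ^ 2)

/-- Euclidean norm of the negative part of `v` restricted to the index set `G`. -/
noncomputable def enormN {α : Type*} (G : Finset α) (v : α → ℝ) : ℝ :=
  Real.sqrt (∑ j ∈ G, (max (-v j) 0) ^ 2)

/-- `‖φ_j(v_G)‖`: the Euclidean norm of `φ_j(v_G)`, where `φ_j(v) = 0` if `v j = 0`,
`φ_j(v) = v⁺` if `v j > 0` and `φ_j(v) = v⁻` if `v j < 0`. -/
noncomputable def phiNorm {α : Type*} (G : Finset α) (v : α → ℝ) (j : α) : ℝ :=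
  if 0 < v j then enormP G v else if v j < 0 then enormN G v else 0

/-- The cooperative-Lasso norm associated with groups `G k` and weights `w k`. -/
noncomputable def coopNorm {p K : ℕ} (G : Fin K → Finset (Fin p)) (w : Fin K → ℝ)
    (v : Fin p → ℝ) : ℝ :=
  ∑ k, w k * (enormP (G k) v + enormN (G k) v)

/-- The coop-Lasso objective `L(β) = (1/2)‖y − Xβ‖² + λ‖β‖_coop`. -/
noncomputable def coopObj {p K n : ℕ} (G : Fin K → Finset (Fin p)) (w : Fin K → ℝ)
    (X : Matrix (Fin n) (Fin p) ℝ) (y : Fin n → ℝ) (lam : ℝ) (β : Fin p → ℝ) : ℝ :=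
  (1 / 2) * (∑ i, (y i - Matrix.mulVec X β i) ^ 2) + lam * coopNorm G w β


section helpers

lemma enormP_nonneg' {α : Type*} (G : Finset α) (v : α → ℝ) : 0 ≤ enormP G v :=
  Real.sqrt_nonneg _

lemma enormP_sq' {α : Type*} (G : Finset α) (v : α → ℝ) :
    enormP G v ^ 2 = ∑ j ∈ G, (max (v j) 0) ^ 2 :=
  Real.sq_sqrt (Finset.sum_nonneg fun _ _ => sq_nonneg _)

lemma enormN_eq {α : Type*} (G : Finset α) (v : α → ℝ) :
    enormN G v = enormP G (fun j => - v j) := rfl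

lemma enormP_cs {α : Type*} (G : Finset α) (u v : α → ℝ) :
    ∑ j ∈ G, max (u j) 0 * max (v j) 0 ≤ enormP G u * enormP G v :=
  Real.sum_mul_le_sqrt_mul_sqrt _ _ _

lemma enormP_add_le {α : Type*} (G : Finset α) (u v : α → ℝ) :
    enormP G (fun j => u j + v j) ≤ enormP G u + enormP G v := by
  have h1 := enormP_nonneg' G u
  have h2 := enormP_nonneg' G v
  refine Real.sqrt_le_iff.2 ⟨by positivity, ?_⟩
  have h : ∑ j ∈ G, (max (u j + v j) 0) ^ 2 ≤
      ∑ j ∈ G, ((max (u j) 0) ^ 2 + 2 * (max (u j) 0 * max (v j) 0) + (max (v j) 0) ^ 2) := by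
    refine Finset.sum_le_sum fun j _ => ?_
    have : max (u j + v j) 0 ≤ max (u j) 0 + max (v j) 0 :=
      max_le (add_le_add (le_max_left _ _) (le_max_left _ _))
        (add_nonneg (le_max_right _ _) (le_max_right _ _))
    have h0 : 0 ≤ max (u j + v j) 0 := le_max_right _ _
    nlinarith
  rw [Finset.sum_add_distrib, Finset.sum_add_distrib, ← Finset.mul_sum, ← enormP_sq' G u,
    ← enormP_sq' G v] at h
  have := enormP_cs G u v
  nlinarith

lemma enormP_smul {α : Type*} (G : Finset α) (u : α → ℝ) (t : ℝ) (ht : 0 ≤ t) :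
    enormP G (fun j => t * u j) = t * enormP G u := by
  have h : ∀ j, (max (t * u j) 0) ^ 2 = t ^ 2 * (max (u j) 0) ^ 2 := by
    intro j
    rw [← mul_pow, mul_max_of_nonneg _ _ ht, mul_zero]
  unfold enormP
  simp_rw [h]
  rw [← Finset.mul_sum, Real.sqrt_mul (sq_nonneg t), Real.sqrt_sq ht]

lemma enormN_add_le {α : Type*} (G : Finset α) (u v : α → ℝ) :
    enormN G (fun j => u j + v j) ≤ enormN G u + enormN G v := by
  rw [enormN_eq, enormN_eq, enormN_eq]
  have := enormP_add_le G (fun j => - u j) (fun j => - v j)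
  simpa only [neg_add] using this

lemma enormN_smul {α : Type*} (G : Finset α) (u : α → ℝ) (t : ℝ) (ht : 0 ≤ t) :
    enormN G (fun j => t * u j) = t * enormN G u := by
  rw [enormN_eq, enormN_eq, ← enormP_smul G _ t ht]
  simp only [mul_neg]

lemma coopNorm_add_le {p K : ℕ} (G : Fin K → Finset (Fin p)) (w : Fin K → ℝ)
    (hw : ∀ k, 0 < w k) (u v : Fin p → ℝ) :
    coopNorm G w (fun j => u j + v j) ≤ coopNorm G w u + coopNorm G w v := by
  unfold coopNorm
  rw [← Finset.sum_add_distrib]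
  refine Finset.sum_le_sum fun k _ => ?_
  have h1 := enormP_add_le (G k) u v
  have h2 := enormN_add_le (G k) u v
  have := hw k
  nlinarith

lemma coopNorm_smul {p K : ℕ} (G : Fin K → Finset (Fin p)) (w : Fin K → ℝ)
    (u : Fin p → ℝ) (t : ℝ) (ht : 0 ≤ t) :
    coopNorm G w (fun j => t * u j) = t * coopNorm G w u := by
  unfold coopNorm
  rw [Finset.mul_sum]
  refine Finset.sum_congr rfl fun k _ => ?_
  rw [enormP_smul _ _ _ ht, enormN_smul _ _ _ ht]
  ring

/-- lower bound on the linear term in a group -/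
lemma group_lower {α : Type*} (G : Finset α) (g u : α → ℝ) (c : ℝ)
    (hP : enormP G g ≤ c) (hN : enormN G g ≤ c) :
    0 ≤ (c * enormP G u - ∑ j ∈ G, max (u j) 0 * max (- g j) 0) ∧
    0 ≤ (c * enormN G u - ∑ j ∈ G, max (- u j) 0 * max (g j) 0) ∧
    - (∑ j ∈ G, max (u j) 0 * max (- g j) 0) - (∑ j ∈ G, max (- u j) 0 * max (g j) 0)
      ≤ ∑ j ∈ G, g j * u j := by
  have h1 := enormP_cs G u (fun j => - g j)
  have h2 := enormP_cs G (fun j => - u j) g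
  rw [enormN_eq] at hN ⊢
  have h3 := enormP_nonneg' G u
  have h4 := enormP_nonneg' G (fun j => - u j)
  refine ⟨by nlinarith, by nlinarith, ?_⟩
  rw [← Finset.sum_neg_distrib, ← Finset.sum_sub_distrib]
  refine Finset.sum_le_sum fun j _ => ?_
  rcases le_total 0 (u j) with hu | hu <;> rcases le_total 0 (g j) with hg | hg <;>
    simp [hu, hg] <;> nlinarith

/-- equality case of Cauchy-Schwarz -/
lemma cs_eq {α : Type*} (G : Finset α) (g u : α → ℝ) (c : ℝ)
    (hP : enormP G g ≤ c) (hN : enormN G g ≤ c)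
    (h : c * enormP G u ≤ ∑ j ∈ G, max (u j) 0 * max (- g j) 0)
    (j : α) (hj : j ∈ G) (hu : 0 < u j) : g j + c * u j / enormP G u = 0 := by
  have hc : 0 ≤ c := (enormP_nonneg' G g).trans hP
  have hpos : 0 < enormP G u := by
    refine Real.sqrt_pos.2 (Finset.sum_pos' (fun _ _ => sq_nonneg _) ⟨j, hj, ?_⟩)
    rw [max_eq_left hu.le]; positivity
  have key : ∑ i ∈ G, (c * max (u i) 0 - enormP G u * max (- g i) 0) ^ 2 ≤ 0 := by
    have e : ∑ i ∈ G, (c * max (u i) 0 - enormP G u * max (- g i) 0) ^ 2 =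
        c ^ 2 * enormP G u ^ 2 - 2 * c * enormP G u * (∑ j ∈ G, max (u j) 0 * max (- g j) 0)
          + enormP G u ^ 2 * enormN G g ^ 2 := by
      rw [enormN_eq, enormP_sq' G (fun j => - g j)]
      have e0 : c ^ 2 * enormP G u ^ 2 = c ^ 2 * ∑ j ∈ G, (max (u j) 0) ^ 2 := by
        rw [enormP_sq' G u]
      rw [e0, Finset.mul_sum, Finset.mul_sum, Finset.mul_sum, ← Finset.sum_sub_distrib,
        ← Finset.sum_add_distrib]
      refine Finset.sum_congr rfl fun i _ => ?_
      ring
    rw [e]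
    have hN0 : 0 ≤ enormN G g := Real.sqrt_nonneg _
    have hN2 : enormN G g ^ 2 ≤ c ^ 2 := by gcongr
    have h5 : enormP G u ^ 2 * enormN G g ^ 2 ≤ enormP G u ^ 2 * c ^ 2 := by gcongr
    have h6 : (2 * c * enormP G u) * (c * enormP G u) ≤ (2 * c * enormP G u) *
      (∑ j ∈ G, max (u j) 0 * max (- g j) 0) := by gcongr
    nlinarith
  have hz := (Finset.sum_eq_zero_iff_of_nonneg (fun _ _ => sq_nonneg _)).1
    (le_antisymm key (Finset.sum_nonneg fun _ _ => sq_nonneg _)) j hj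
  have hz' : c * u j = enormP G u * max (- g j) 0 := by
    have := pow_eq_zero_iff (two_ne_zero) |>.1 hz
    rw [max_eq_left hu.le] at this
    linarith
  have hg : max (- g j) 0 = - g j := by
    refine max_eq_left ?_
    by_contra hlt
    push Not at hlt
    rw [max_eq_right hlt.le, mul_zero] at hz'
    have hc0 : c = 0 := by
      rcases mul_eq_zero.1 hz' with h | h
      · exact h
      · exact absurd h hu.ne'
    have : enormP G g ^ 2 ≤ 0 := by
      have := enormP_nonneg' G g
      nlinarith
    rw [enormP_sq'] at this
    have h7 := Finset.single_le_sum (f := fun j => (max (g j) 0) ^ 2)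
      (fun _ _ => sq_nonneg _) hj
    have hgj : 0 < g j := by linarith
    simp only [max_eq_left hgj.le] at h7
    nlinarith
  rw [hz', hg]
  field_simp
  ring

/-- from the pointwise conditions to a bound on the positive part of `g` -/
lemma cond_bound {α : Type*} (G : Finset α) (g β : α → ℝ) (c : ℝ) (hc : 0 ≤ c)
    (h1 : ∀ j ∈ G, 0 < β j → g j ≤ 0)
    (h2 : ∀ j ∈ G, β j < 0 → g j + c * β j / enormN G β = 0)
    (h3 : ∀ j ∈ G, β j = 0 → 0 < g j → enormP G g ≤ c) : enormP G g ≤ c := by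
  by_cases hex : ∃ j ∈ G, β j = 0 ∧ 0 < g j
  · obtain ⟨j, hj, hb, hg⟩ := hex
    exact h3 j hj hb hg
  push Not at hex
  have hN0 : 0 ≤ enormN G β := Real.sqrt_nonneg _
  have e : ∀ j ∈ G, (max (g j) 0) ^ 2 = (c / enormN G β) ^ 2 * (max (- β j) 0) ^ 2 := by
    intro j hj
    rcases lt_trichotomy (β j) 0 with hb | hb | hb
    · have hg : g j = c / enormN G β * (- β j) := by
        have := h2 j hj hb
        have e : c / enormN G β * (- β j) = - (c * β j / enormN G β) := by ring
        rw [e]; linarith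
      have hg0 : 0 ≤ g j := by
        rw [hg]; exact mul_nonneg (by positivity) (by linarith)
      rw [max_eq_left hg0, max_eq_left (by linarith : 0 ≤ - β j), hg, mul_pow]
    · rw [max_eq_right (hex j hj hb), hb]; simp
    · rw [max_eq_right (h1 j hj hb), max_eq_right (by linarith : - β j ≤ 0)]; simp
  have hs : enormP G g ^ 2 = (c / enormN G β) ^ 2 * enormN G β ^ 2 := by
    rw [enormP_sq', Finset.sum_congr rfl e, ← Finset.mul_sum, enormN_eq, enormP_sq']
  refine abs_le_of_sq_le_sq' ?_ hc |>.2
  rw [hs]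
  by_cases h0 : enormN G β = 0
  · rw [h0]; simp; positivity
  · rw [div_pow, div_mul_cancel₀ _ (pow_ne_zero _ h0)]

lemma phi_pos {α : Type*} (G : Finset α) (v : α → ℝ) (j : α) (h : 0 < v j) :
    phiNorm G v j = enormP G v := by simp [phiNorm, h]

lemma phi_neg {α : Type*} (G : Finset α) (v : α → ℝ) (j : α) (h : v j < 0) :
    phiNorm G v j = enormN G v := by simp [phiNorm, h, h.le, not_lt.2 h.le]

/-- per-group equivalence -/
lemma group_iff {α : Type*} (G : Finset α) (g β : α → ℝ) (c : ℝ) (hc : 0 ≤ c) :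
    (enormP G g ≤ c ∧ enormN G g ≤ c ∧
      ∑ j ∈ G, g j * β j + c * (enormP G β + enormN G β) ≤ 0) ↔
    ((∀ j ∈ G, β j ≠ 0 → g j + c * β j / phiNorm G β j = 0) ∧
      (∀ j ∈ G, β j = 0 → phiNorm G g j ≤ c)) := by
  constructor
  · rintro ⟨hP, hN, hs⟩
    obtain ⟨a1, a2, a3⟩ := group_lower G g β c hP hN
    refine ⟨?_, ?_⟩
    · intro j hj hb
      rcases lt_or_gt_of_ne hb with hb | hb
      · rw [phi_neg _ _ _ hb]
        have := cs_eq G (fun j => - g j) (fun j => - β j) c hN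
          (by rw [enormN_eq]; simpa using hP)
          (by simp only [neg_neg]; rw [← enormN_eq]; linarith) j hj (by linarith)
        rw [← enormN_eq] at this
        have e : c * (- β j) / enormN G β = - (c * β j / enormN G β) := by ring
        rw [e] at this
        linarith
      · rw [phi_pos _ _ _ hb]
        exact cs_eq G g β c hP hN (by linarith) j hj hb
    · intro j hj hb
      unfold phiNorm
      split_ifs <;> assumption
  · rintro ⟨h1, h2⟩
    have hP0 : 0 ≤ enormP G β := Real.sqrt_nonneg _
    have hN0 : 0 ≤ enormN G β := Real.sqrt_nonneg _
    have p1 : ∀ j ∈ G, 0 < β j → g j + c * β j / enormP G β = 0 := fun j hj hb => by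
      rw [← phi_pos G β j hb]; exact h1 j hj hb.ne'
    have p2 : ∀ j ∈ G, β j < 0 → g j + c * β j / enormN G β = 0 := fun j hj hb => by
      rw [← phi_neg G β j hb]; exact h1 j hj hb.ne
    refine ⟨?_, ?_, ?_⟩
    · refine cond_bound G g β c hc ?_ p2 ?_
      · intro j hj hb
        have := p1 j hj hb
        have : 0 ≤ c * β j / enormP G β := by positivity
        linarith
      · intro j hj hb hg
        rw [← phi_pos G g j hg]; exact h2 j hj hb
    · rw [enormN_eq]
      refine cond_bound G (fun j => - g j) (fun j => - β j) c hc ?_ ?_ ?_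
      · intro j hj hb
        have := p2 j hj (by linarith)
        have h3 : 0 ≤ c * (- β j) / enormN G β := by positivity
        have e : c * (- β j) / enormN G β = - (c * β j / enormN G β) := by ring
        rw [e] at h3
        linarith
      · intro j hj hb
        have := p1 j hj (by linarith)
        rw [enormN_eq]
        simp only [neg_neg]
        have e : c * (- β j) / enormP G β = - (c * β j / enormP G β) := by ring
        change - g j + c * (- β j) / enormP G β = 0
        rw [e]
        linarith
      · intro j hj hb hg
        rw [← enormN_eq, ← phi_neg G g j (by linarith)]
        exact h2 j hj (by linarith)
    · have e : ∀ j ∈ G, g j * β j = - (c / enormP G β) * (max (β j) 0) ^ 2 +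
          - (c / enormN G β) * (max (- β j) 0) ^ 2 := by
        intro j hj
        rcases lt_trichotomy (β j) 0 with hb | hb | hb
        · rw [max_eq_right hb.le, max_eq_left (by linarith : 0 ≤ - β j),
            eq_neg_of_add_eq_zero_left (p2 j hj hb)]
          ring
        · rw [hb]; simp
        · rw [max_eq_left hb.le, max_eq_right (by linarith : - β j ≤ 0),
            eq_neg_of_add_eq_zero_left (p1 j hj hb)]
          ring
      rw [Finset.sum_congr rfl e, Finset.sum_add_distrib, ← Finset.mul_sum, ← Finset.mul_sum,
        ← enormP_sq', ← enormP_sq' G (fun j => - β j), ← enormN_eq]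
      have q : ∀ x : ℝ, c / x * x ^ 2 = c * x := by
        intro x
        by_cases hx : x = 0
        · simp [hx]
        · field_simp
      rw [neg_mul, neg_mul, q, q]
      linarith

lemma sum_groups {p K : ℕ} (G : Fin K → Finset (Fin p))
    (hcover : ∀ j : Fin p, ∃ k, j ∈ G k)
    (hdisj : ∀ k l : Fin K, k ≠ l → Disjoint (G k) (G l)) (f : Fin p → ℝ) :
    ∑ j, f j = ∑ k, ∑ j ∈ G k, f j := by
  rw [← Finset.sum_biUnion (fun k _ l _ h => hdisj k l h)]
  refine Finset.sum_congr ?_ fun _ _ => rfl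
  ext j
  simpa using hcover j

lemma obj_expand {p K n : ℕ} (G : Fin K → Finset (Fin p)) (w : Fin K → ℝ)
    (X : Matrix (Fin n) (Fin p) ℝ) (y : Fin n → ℝ) (lam : ℝ) (β d : Fin p → ℝ) (t : ℝ) :
    coopObj G w X y lam (fun j => β j + t * d j) =
      (1 / 2) * (∑ i, (y i - Matrix.mulVec X β i) ^ 2) +
      t * (∑ j, (∑ i, X i j * (Matrix.mulVec X β i - y i)) * d j) +
      t ^ 2 * ((1 / 2) * ∑ i, (Matrix.mulVec X d i) ^ 2) +
      lam * coopNorm G w (fun j => β j + t * d j) := by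
  unfold coopObj
  have e1 : ∀ i, Matrix.mulVec X (fun j => β j + t * d j) i =
      Matrix.mulVec X β i + t * Matrix.mulVec X d i := by
    intro i
    simp only [Matrix.mulVec, dotProduct, Finset.mul_sum]
    rw [← Finset.sum_add_distrib]
    exact Finset.sum_congr rfl fun j _ => by ring
  have e2 : ∑ j, (∑ i, X i j * (Matrix.mulVec X β i - y i)) * d j =
      ∑ i, (Matrix.mulVec X β i - y i) * Matrix.mulVec X d i := by
    simp_rw [Finset.sum_mul]
    rw [Finset.sum_comm]
    refine Finset.sum_congr rfl fun i _ => ?_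
    rw [show Matrix.mulVec X d i = ∑ j, X i j * d j from rfl, Finset.mul_sum]
    exact Finset.sum_congr rfl fun j _ => by ring
  rw [e2]
  congr 1
  simp_rw [e1]
  simp only [Finset.mul_sum]
  rw [← Finset.sum_add_distrib, ← Finset.sum_add_distrib]
  exact Finset.sum_congr rfl fun i _ => by ring

lemma lin_nonneg (a c : ℝ) (hc : 0 ≤ c)
    (h : ∀ t : ℝ, 0 < t → t ≤ 1 → 0 ≤ t * a + t ^ 2 * c) : 0 ≤ a := by
  by_contra ha
  push Not at ha
  have hpos : 0 < - a + c := by linarith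
  have hd : 0 < 2 * (- a + c) := by linarith
  have ht : 0 < (- a) / (2 * (- a + c)) := div_pos (by linarith) hd
  have h2 := h _ ht (by rw [div_le_one hd]; linarith)
  set t := (- a) / (2 * (- a + c)) with htd
  have e : t * (2 * (- a + c)) = - a := by rw [htd]; field_simp
  have h3 : 0 ≤ t * (a + t * c) := by nlinarith
  have h4 : 0 ≤ a + t * c := nonneg_of_mul_nonneg_right h3 ht
  nlinarith

/-- optimality along the group-restricted direction `-g⁺` -/
lemma bound_of_dir {p K : ℕ} (G : Fin K → Finset (Fin p)) (w : Fin K → ℝ)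
    (hdisj : ∀ k l : Fin K, k ≠ l → Disjoint (G k) (G l))
    (lam : ℝ) (g : Fin p → ℝ) (s : ℝ) (hs : s = 1 ∨ s = -1)
    (h : ∀ d : Fin p → ℝ, 0 ≤ ∑ j, g j * d j + lam * coopNorm G w d) (k : Fin K)
    (hc : 0 ≤ lam * w k) :
    enormP (G k) (fun j => s * g j) ≤ lam * w k := by
  classical
  set P := enormP (G k) (fun j => s * g j) with hP
  have hP0 : 0 ≤ P := Real.sqrt_nonneg _
  have hss : s * s = 1 := by rcases hs with h | h <;> rw [h] <;> norm_num
  have hd := h (fun j => if j ∈ G k then - s * max (s * g j) 0 else 0)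
  have e1 : ∑ j, g j * (if j ∈ G k then - s * max (s * g j) 0 else 0) = - P ^ 2 := by
    rw [hP, enormP_sq']
    simp only [mul_ite, mul_zero]
    rw [Finset.sum_ite_mem, Finset.univ_inter, ← Finset.sum_neg_distrib]
    refine Finset.sum_congr rfl fun j _ => ?_
    rcases le_total 0 (s * g j) with hj | hj
    · rw [max_eq_left hj]; ring
    · rw [max_eq_right hj]; ring
  have e2 : coopNorm G w (fun j => if j ∈ G k then - s * max (s * g j) 0 else 0) = w k * P := by
    unfold coopNorm
    rw [Finset.sum_eq_single k]
    · congr 1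
      have z : ∀ j, max (- max (s * g j) 0) 0 = 0 := fun j => by
        rw [max_eq_right]; simp
      have z2 : ∀ j, max (max (s * g j) 0) 0 = max (s * g j) 0 := fun j => by simp
      rcases hs with h1 | h1
      · have a1 : enormP (G k) (fun j => if j ∈ G k then - s * max (s * g j) 0 else 0) = 0 := by
          unfold enormP
          rw [Finset.sum_eq_zero, Real.sqrt_zero]
          intro j hj
          have := z j
          simp only [if_pos hj]
          rw [show - s * max (s * g j) 0 = - max (s * g j) 0 by rw [h1]; ring, this]; simp
        have a2 : enormN (G k) (fun j => if j ∈ G k then - s * max (s * g j) 0 else 0) = P := by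
          rw [hP]
          unfold enormP enormN
          congr 1
          refine Finset.sum_congr rfl fun j hj => ?_
          simp only [if_pos hj]
          rw [show - (- s * max (s * g j) 0) = max (s * g j) 0 by rw [h1]; ring, z2]
        rw [a1, a2, zero_add]
      · have a1 : enormN (G k) (fun j => if j ∈ G k then - s * max (s * g j) 0 else 0) = 0 := by
          unfold enormN
          rw [Finset.sum_eq_zero, Real.sqrt_zero]
          intro j hj
          have := z j
          simp only [if_pos hj]
          rw [show - (- s * max (s * g j) 0) = - max (s * g j) 0 by rw [h1]; ring, this]; simp
        have a2 : enormP (G k) (fun j => if j ∈ G k then - s * max (s * g j) 0 else 0) = P := by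
          rw [hP]
          unfold enormP
          congr 1
          refine Finset.sum_congr rfl fun j hj => ?_
          simp only [if_pos hj]
          rw [show (- s * max (s * g j) 0) = max (s * g j) 0 by rw [h1]; ring, z2]
        rw [a1, a2, add_zero]
    · intro l _ hl
      have a : ∀ j ∈ G l, j ∉ G k := fun j hj => Finset.disjoint_left.1 (hdisj l k hl) hj
      have b1 : enormP (G l) (fun j => if j ∈ G k then - s * max (s * g j) 0 else 0) = 0 := by
        unfold enormP
        rw [Finset.sum_eq_zero, Real.sqrt_zero]
        intro j hj
        simp [a j hj]
      have b2 : enormN (G l) (fun j => if j ∈ G k then - s * max (s * g j) 0 else 0) = 0 := by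
        unfold enormN
        rw [Finset.sum_eq_zero, Real.sqrt_zero]
        intro j hj
        simp [a j hj]
      rw [b1, b2]; simp
    · simp
  rw [e1, e2] at hd
  by_contra hlt
  push Not at hlt
  nlinarith

end helpers

/-- optimality conditions for the coop-Lasso. `β` is a global minimizer of
the coop-Lasso objective iff (i) for every `k` and `j ∈ G k` with `β j ≠ 0`,
`x_jᵀ(Xβ − y) + λ w_k β_j/‖φ_j(β_{G_k})‖ = 0`, and (ii) for every `k` and `j ∈ G k`
with `β j = 0`, `‖φ_j((X_{·G_k})ᵀ(Xβ − y))‖ ≤ λ w_k`. -/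
theorem coopLasso_optimality (p K n : ℕ) (hp : 1 ≤ p) (hn : 1 ≤ n)
    (G : Fin K → Finset (Fin p))
    (hcover : ∀ j : Fin p, ∃ k, j ∈ G k)
    (hdisj : ∀ k l : Fin K, k ≠ l → Disjoint (G k) (G l))
    (w : Fin K → ℝ) (hw : ∀ k, 0 < w k)
    (X : Matrix (Fin n) (Fin p) ℝ) (y : Fin n → ℝ)
    (lam : ℝ) (hlam : 0 ≤ lam) (β : Fin p → ℝ) :
    (∀ u : Fin p → ℝ, coopObj G w X y lam β ≤ coopObj G w X y lam u) ↔
    ((∀ k, ∀ j ∈ G k, β j ≠ 0 →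
        (∑ i, X i j * (Matrix.mulVec X β i - y i)) +
          lam * w k * β j / phiNorm (G k) β j = 0) ∧
     (∀ k, ∀ j ∈ G k, β j = 0 →
        phiNorm (G k) (fun l => ∑ i, X i l * (Matrix.mulVec X β i - y i)) j ≤ lam * w k)) := by
  set g : Fin p → ℝ := fun l => ∑ i, X i l * (Matrix.mulVec X β i - y i) with hg
  have hc : ∀ k, 0 ≤ lam * w k := fun k => mul_nonneg hlam (hw k).le
  have hcoop : ∀ v, lam * coopNorm G w v =
      ∑ k, lam * w k * (enormP (G k) v + enormN (G k) v) := by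
    intro v
    unfold coopNorm
    rw [Finset.mul_sum]
    exact Finset.sum_congr rfl fun k _ => by ring
  have hmid : ((∀ k, ∀ j ∈ G k, β j ≠ 0 →
        g j + lam * w k * β j / phiNorm (G k) β j = 0) ∧
      (∀ k, ∀ j ∈ G k, β j = 0 → phiNorm (G k) g j ≤ lam * w k)) ↔
      ∀ k, (enormP (G k) g ≤ lam * w k ∧ enormN (G k) g ≤ lam * w k ∧
      ∑ j ∈ G k, g j * β j + lam * w k * (enormP (G k) β + enormN (G k) β) ≤ 0) := by
    rw [← forall_and]
    exact forall_congr' fun k => (group_iff (G k) g β _ (hc k)).symm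
  refine Iff.trans ?_ hmid.symm
  have hobj : coopObj G w X y lam β =
      (1 / 2) * (∑ i, (y i - Matrix.mulVec X β i) ^ 2) + lam * coopNorm G w β := rfl
  constructor
  · intro hmin
    have hquad : ∀ d : Fin p → ℝ, 0 ≤ (1 / 2) * ∑ i, (Matrix.mulVec X d i) ^ 2 := fun d => by
      positivity
    have hdir : ∀ d : Fin p → ℝ, 0 ≤ ∑ j, g j * d j + lam * coopNorm G w d := by
      intro d
      refine lin_nonneg _ _ (hquad d) fun t ht _ => ?_
      have h1 := hmin (fun j => β j + t * d j)
      rw [obj_expand, hobj] at h1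
      have h2 := coopNorm_add_le G w hw β (fun j => t * d j)
      rw [coopNorm_smul G w d t ht.le] at h2
      have h3 := mul_le_mul_of_nonneg_left h2 hlam
      linarith
    have hPk : ∀ k, enormP (G k) g ≤ lam * w k := fun k => by
      simpa using bound_of_dir G w hdisj lam g 1 (Or.inl rfl) hdir k (hc k)
    have hNk : ∀ k, enormN (G k) g ≤ lam * w k := fun k => by
      simpa [enormN_eq] using bound_of_dir G w hdisj lam g (-1) (Or.inr rfl) hdir k (hc k)
    have htot : ∑ j, g j * β j + lam * coopNorm G w β ≤ 0 := by
      have : 0 ≤ - (∑ j, g j * β j + lam * coopNorm G w β) := by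
        refine lin_nonneg _ _ (hquad (fun j => - β j)) fun t ht ht1 => ?_
        have h1 := hmin (fun j => β j + t * (- β j))
        rw [obj_expand G w X y lam β (fun j => - β j) t, hobj] at h1
        have e : (fun j => β j + t * (- β j)) = fun j => (1 - t) * β j := by
          funext j; ring
        rw [e, coopNorm_smul G w β (1 - t) (by linarith)] at h1
        have e2 : ∑ j, (∑ i, X i j * (Matrix.mulVec X β i - y i)) * (- β j) =
            - ∑ j, g j * β j := by
          rw [← Finset.sum_neg_distrib]
          exact Finset.sum_congr rfl fun j _ => by rw [hg]; ring
        rw [e2] at h1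
        linarith
      linarith
    rw [sum_groups G hcover hdisj, hcoop, ← Finset.sum_add_distrib] at htot
    have hnn : ∀ k ∈ Finset.univ, 0 ≤ ∑ j ∈ G k, g j * β j +
        lam * w k * (enormP (G k) β + enormN (G k) β) := by
      intro k _
      obtain ⟨a1, a2, a3⟩ := group_lower (G k) g β _ (hPk k) (hNk k)
      linarith
    intro k
    exact ⟨hPk k, hNk k, (Finset.single_le_sum hnn (Finset.mem_univ k)).trans htot⟩
  · intro hA u
    have hu : u = fun j => β j + 1 * (u j - β j) := by funext j; ring
    have e := obj_expand G w X y lam β (fun j => u j - β j) 1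
    rw [← hu] at e
    rw [e, hobj]
    have hq : 0 ≤ (1 : ℝ) ^ 2 * ((1 / 2) * ∑ i, (Matrix.mulVec X (fun j => u j - β j) i) ^ 2) := by
      positivity
    have hlin : 0 ≤ ∑ j, g j * (u j - β j) + lam * coopNorm G w u - lam * coopNorm G w β := by
      rw [sum_groups G hcover hdisj, hcoop, hcoop, ← Finset.sum_add_distrib,
        ← Finset.sum_sub_distrib]
      refine Finset.sum_nonneg fun k _ => ?_
      obtain ⟨h1, h2, h3⟩ := hA k
      obtain ⟨a1, a2, a3⟩ := group_lower (G k) g u _ h1 h2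
      simp_rw [mul_sub]
      rw [Finset.sum_sub_distrib]
      linarith
    linarith
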